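/- Let a, h > 0, R = (0,h) × (0,a), γ = 2α with α ∈ [0,1/2), and let 𝐔 = (u,v) ∈ C¹(R̄,ℝ²) ∩ H¹(R,ℝ²). Let ũ ∈ H¹(R) be the unique harmonic function in R with ũ = u on ∂R. Then the weighted L² bound holds: ‖y^α (u − ũ)‖_{L²(R)} ≤ h·‖y^α (u − ũ)_x‖_{L²(R)} ≤ (4h/(1−γ)) ‖y^α e(𝐔)‖_{L²(R)}, where e(𝐔) = (∇𝐔 + ∇𝐔ᵀ)/2 and y denotes the second coordinate in R. -/

import Mathlib

open MeasureTheory Set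

/-- Partial derivative in the first (thin) direction of a function on `ℝ² = ℝ × ℝ`. -/
noncomputable def d₁ (f : ℝ × ℝ → ℝ) (p : ℝ × ℝ) : ℝ := fderiv ℝ f p (1, 0)

/-- Partial derivative in the second direction. -/
noncomputable def d₂ (f : ℝ × ℝ → ℝ) (p : ℝ × ℝ) : ℝ := fderiv ℝ f p (0, 1)

/-- The Laplacian of a function on `ℝ²`. -/
noncomputable def lap (f : ℝ × ℝ → ℝ) (p : ℝ × ℝ) : ℝ :=
  fderiv ℝ (fun q => d₁ f q) p (1, 0) + fderiv ℝ (fun q => d₂ f q) p (0, 1)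

/-- Squared Frobenius norm of the symmetrized gradient `e(𝐔) = (∇𝐔 + ∇𝐔ᵀ)/2`. -/
noncomputable def strainNormSq (U : ℝ × ℝ → ℝ × ℝ) (p : ℝ × ℝ) : ℝ :=
  (d₁ (fun q => (U q).1) p) ^ 2 + (d₂ (fun q => (U q).2) p) ^ 2 +
  2 * ((d₂ (fun q => (U q).1) p + d₁ (fun q => (U q).2) p) / 2) ^ 2


open Topology Filter

lemma hr_ext_contDiff {n : WithTop ℕ∞} {R K : Set (ℝ × ℝ)} (hR : IsOpen R) (hK : IsClosed K)
    (hKR : K ⊆ R) {f : ℝ × ℝ → ℝ} (hf : ContDiffOn ℝ n f R) (h0 : ∀ p ∈ R, p ∉ K → f p = 0) :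
    ContDiff ℝ n (R.indicator f) := by
  rw [contDiff_iff_contDiffAt]
  intro p
  by_cases hp : p ∈ R
  · refine (hf.contDiffAt (hR.mem_nhds hp)).congr_of_eventuallyEq ?_
    filter_upwards [hR.mem_nhds hp] with q hq
    simp [hq]
  · have hpK : p ∉ K := fun h => hp (hKR h)
    refine (contDiffAt_const (c := (0:ℝ))).congr_of_eventuallyEq ?_
    filter_upwards [hK.isOpen_compl.mem_nhds hpK] with q hq
    by_cases hqR : q ∈ R
    · simp [hqR, h0 q hqR hq]
    · simp [hqR]

lemma hr_ext_supp {R K : Set (ℝ × ℝ)} (hK : IsCompact K)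
    {f : ℝ × ℝ → ℝ} (h0 : ∀ p ∈ R, p ∉ K → f p = 0) :
    HasCompactSupport (R.indicator f) := by
  refine HasCompactSupport.intro hK ?_
  intro q hq
  by_cases hqR : q ∈ R
  · simp [hqR, h0 q hqR hq]
  · simp [hqR]

open Classical in
lemma hr_fderiv_ind {R K : Set (ℝ × ℝ)} (hR : IsOpen R) (hK : IsClosed K)
    (hKR : K ⊆ R) {f : ℝ × ℝ → ℝ} (h0 : ∀ p ∈ R, p ∉ K → f p = 0) (p : ℝ × ℝ) :
    fderiv ℝ (R.indicator f) p = if p ∈ K then fderiv ℝ f p else 0 := by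
  split_ifs with hp
  · apply Filter.EventuallyEq.fderiv_eq
    filter_upwards [hR.mem_nhds (hKR hp)] with q hq
    simp [hq]
  · have : R.indicator f =ᶠ[𝓝 p] fun _ => (0:ℝ) := by
      filter_upwards [hK.isOpen_compl.mem_nhds hp] with q hq
      by_cases hqR : q ∈ R
      · simp [hqR, h0 q hqR hq]
      · simp [hqR]
    rw [this.fderiv_eq]; simp

lemma hr_fderiv_out {R K : Set (ℝ × ℝ)} (hR : IsOpen R) (hK : IsClosed K)
     {f : ℝ × ℝ → ℝ} (h0 : ∀ p ∈ R, p ∉ K → f p = 0) (p : ℝ × ℝ) (hp : p ∈ R)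
    (hpK : p ∉ K) : fderiv ℝ f p = 0 := by
  have : f =ᶠ[𝓝 p] fun _ => (0:ℝ) := by
    filter_upwards [hK.isOpen_compl.mem_nhds hpK, hR.mem_nhds hp] with q hq hqR
    exact h0 q hqR hq
  rw [this.fderiv_eq]; simp

lemma hr_int_zero {F : ℝ × ℝ → ℝ} (hF : ContDiff ℝ 1 F) (hs : HasCompactSupport F) (e : ℝ × ℝ) :
    Integrable (fun p => fderiv ℝ F p e) ∧ ∫ p, fderiv ℝ F p e = 0 := by
  have hi : Integrable (fun p => fderiv ℝ F p e) := by
    refine Continuous.integrable_of_hasCompactSupport ?_ ?_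
    · exact (hF.continuous_fderiv one_ne_zero).clm_apply continuous_const
    · exact hs.fderiv_apply ℝ e
  refine ⟨hi, ?_⟩
  have := integral_bilinear_hasFDerivAt_right_eq_neg_left_of_integrable (μ := volume)
    (f := fun _ : ℝ × ℝ => (1:ℝ)) (f' := fun _ => 0) (g := F) (g' := fderiv ℝ F) (v := e)
    (B := ContinuousLinearMap.mul ℝ ℝ) (by simp) (by simpa using hi)
    (by simpa using hF.continuous.integrable_of_hasCompactSupport hs)
    (fun x _ => hasFDerivAt_const _ _)
    (fun x _ => (hF.differentiable one_ne_zero x).hasFDerivAt)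
  simpa using this

lemma hr_int_zero_on {R K : Set (ℝ × ℝ)} (hR : IsOpen R) (hK : IsCompact K)
    (hKR : K ⊆ R) {f : ℝ × ℝ → ℝ} (hf : ContDiffOn ℝ 1 f R) (h0 : ∀ p ∈ R, p ∉ K → f p = 0)
    (e : ℝ × ℝ) :
    IntegrableOn (fun p => fderiv ℝ f p e) R ∧ ∫ p in R, fderiv ℝ f p e = 0 := by
  obtain ⟨h1, h2⟩ := hr_int_zero (hr_ext_contDiff hR hK.isClosed hKR hf h0) (hr_ext_supp hK h0) e
  have key : ∀ p ∈ R, fderiv ℝ (R.indicator f) p e = fderiv ℝ f p e := by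
    intro p hp
    rw [hr_fderiv_ind hR hK.isClosed hKR h0]
    split_ifs with hk
    · rfl
    · rw [hr_fderiv_out hR hK.isClosed h0 p hp hk]
  constructor
  · exact h1.integrableOn.congr_fun key hR.measurableSet
  · rw [← setIntegral_congr_fun hR.measurableSet key,
      setIntegral_eq_integral_of_forall_compl_eq_zero, h2]
    intro p hp
    rw [hr_fderiv_ind hR hK.isClosed hKR h0, if_neg (fun h => hp (hKR h))]; rfl

lemma hr_deriv_shift {f g : ℝ × ℝ → ℝ} (hf : Continuous f) (hfs : HasCompactSupport f)
    (hg : ContDiff ℝ 1 g) (hgs : HasCompactSupport g) (e : ℝ × ℝ) :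
    HasDerivAt (fun t : ℝ => ∫ p, f p * g (p + t • e)) (∫ p, f p * fderiv ℝ g p e) 0 := by
  have hgc : Continuous (fun p => fderiv ℝ g p e) :=
    (hg.continuous_fderiv one_ne_zero).clm_apply continuous_const
  obtain ⟨M, hM⟩ := hgc.bounded_above_of_compact_support (hgs.fderiv_apply ℝ e)
  have hsh : ∀ t : ℝ, Continuous (fun p : ℝ × ℝ => p + t • e) := fun t => by fun_prop
  have := (hasDerivAt_integral_of_dominated_loc_of_deriv_le (μ := (volume : Measure (ℝ × ℝ)))
    (F := fun (t : ℝ) p => f p * g (p + t • e)) (F' := fun (t : ℝ) p => f p * fderiv ℝ g (p + t • e) e)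
    (x₀ := (0:ℝ)) (s := univ) (bound := fun p => ‖f p‖ * M) univ_mem ?_ ?_ ?_ ?_ ?_ ?_).2
  · simpa using this
  · exact Eventually.of_forall fun t => (hf.mul (hg.continuous.comp (hsh t))).aestronglyMeasurable
  · exact (hf.mul (hg.continuous.comp (hsh 0))).integrable_of_hasCompactSupport hfs.mul_right
  · exact (hf.mul (hgc.comp (hsh 0))).aestronglyMeasurable
  · refine Eventually.of_forall fun p t _ => ?_
    rw [norm_mul]
    exact mul_le_mul_of_nonneg_left (hM _) (norm_nonneg _)
  · exact (hf.norm.integrable_of_hasCompactSupport hfs.norm).mul_const M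
  · refine Eventually.of_forall fun p t _ => ?_
    refine HasDerivAt.const_mul _ ?_
    have h1 : HasDerivAt (fun t : ℝ => p + t • e) e t := by
      simpa using ((hasDerivAt_id t).smul_const e).const_add p
    exact ((hg.differentiable one_ne_zero _).hasFDerivAt.comp_hasDerivAt t h1)

lemma hr_mixed {V φ : ℝ × ℝ → ℝ} (hV : ContDiff ℝ 1 V) (hVs : HasCompactSupport V)
    (hφ : ContDiff ℝ 1 φ) (hφs : HasCompactSupport φ) (e e' : ℝ × ℝ) :
    ∫ p, fderiv ℝ V p e' * fderiv ℝ φ p e = ∫ p, fderiv ℝ V p e * fderiv ℝ φ p e' := by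
  have hVc : ∀ e, Continuous (fun p => fderiv ℝ V p e) := fun e =>
    (hV.continuous_fderiv one_ne_zero).clm_apply continuous_const
  have hφc : ∀ e, Continuous (fun p => fderiv ℝ φ p e) := fun e =>
    (hφ.continuous_fderiv one_ne_zero).clm_apply continuous_const
  have h1 := hr_deriv_shift (hVc e') (hVs.fderiv_apply ℝ e') hφ hφs e
  have h2 := hr_deriv_shift (hφc e') (hφs.fderiv_apply ℝ e') hV hVs (-e)
  have h3 : (fun t : ℝ => ∫ p, fderiv ℝ V p e' * φ (p + t • e)) =
      fun t => - ∫ p, fderiv ℝ φ p e' * V (p + t • (-e)) := by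
    funext t
    have hsh : ContDiff ℝ 1 (fun p => φ (p + t • e)) := by fun_prop
    have hD : ∀ p, fderiv ℝ (fun p => φ (p + t • e)) p = fderiv ℝ φ (p + t • e) := by
      intro p; exact fderiv_comp_add_right (𝕜 := ℝ) (f := φ) (x := p) (t • e)
    have hp := (hr_int_zero (hV.mul hsh) hVs.mul_right e').2
    have hx : ∀ p, fderiv ℝ (V * fun p => φ (p + t • e)) p e' =
        V p * fderiv ℝ φ (p + t • e) e' + fderiv ℝ V p e' * φ (p + t • e) := by
      intro p
      rw [fderiv_mul (hV.differentiable one_ne_zero p) (hsh.differentiable one_ne_zero p), hD]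
      simp [mul_comm]
    rw [show (∫ p, fderiv ℝ φ p e' * V (p + t • (-e))) =
      ∫ p, (fun q => fderiv ℝ φ q e' * V (q + t • (-e))) (p + t • e) from
        (integral_add_right_eq_self _ _).symm]
    have hx' : ∀ p, fderiv ℝ (fun p => V p * φ (p + t • e)) p e' =
        V p * fderiv ℝ φ (p + t • e) e' + fderiv ℝ V p e' * φ (p + t • e) := hx
    simp_rw [hx'] at hp
    rw [integral_add] at hp
    · simp only [smul_neg, add_neg_cancel_right]
      simp_rw [mul_comm (fderiv ℝ φ _ _)]
      linarith
    · refine Continuous.integrable_of_hasCompactSupport ?_ hVs.mul_right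
      exact hV.continuous.mul ((hφc e').comp (by fun_prop))
    · refine Continuous.integrable_of_hasCompactSupport ?_ (hVs.fderiv_apply ℝ e').mul_right
      exact (hVc e').mul hsh.continuous
  rw [h3] at h1
  have := h1.unique h2.neg
  rw [this, ← integral_neg]
  congr 1; ext p; simp [mul_comm]

lemma hr_mixed_on {R K : Set (ℝ × ℝ)} (hR : IsOpen R) (hK : IsCompact K)
    (hKR : K ⊆ R) {f v : ℝ × ℝ → ℝ} (hf : ContDiffOn ℝ 1 f R) (h0 : ∀ p ∈ R, p ∉ K → f p = 0)
    (hv : ContDiffOn ℝ 1 v R) (e e' : ℝ × ℝ) :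
    IntegrableOn (fun p => fderiv ℝ v p e' * fderiv ℝ f p e - fderiv ℝ v p e * fderiv ℝ f p e') R ∧
    ∫ p in R, (fderiv ℝ v p e' * fderiv ℝ f p e - fderiv ℝ v p e * fderiv ℝ f p e') = 0 := by
  obtain ⟨L, hL, hKL, hLR⟩ := exists_compact_between hK hR hKR
  obtain ⟨χ, hχ0, hχ1, -⟩ := exists_contMDiffMap_zero_one_nhds_of_isClosed (n := 1)
    (modelWithCornersSelf ℝ (ℝ × ℝ))
    (isOpen_interior (s := L)).isClosed_compl hK.isClosed
    (by rw [Set.disjoint_left]; intro x hx hx'; exact hx (hKL hx'))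
  have hχ : ContDiff ℝ 1 χ := χ.contMDiff.contDiff
  have g0 : ∀ p ∈ R, p ∉ L → (fun q => χ q * v q) p = 0 := by
    intro p _ hpL
    have : χ p = 0 := (hχ0.filter_mono (nhds_le_nhdsSet
      (show p ∈ (interior L)ᶜ from fun h => hpL (interior_subset h)))).self_of_nhds
    simp [this]
  have hg : ContDiffOn ℝ 1 (fun q => χ q * v q) R := hχ.contDiffOn.mul hv
  have A := hr_ext_contDiff hR hK.isClosed hKR hf h0
  have As := hr_ext_supp hK h0
  have B := hr_ext_contDiff hR hL.isClosed hLR hg g0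
  have Bs := hr_ext_supp hL g0
  have hc : ∀ {F : ℝ × ℝ → ℝ}, ContDiff ℝ 1 F → ∀ e, Continuous (fun p => fderiv ℝ F p e) :=
    fun h e => (h.continuous_fderiv one_ne_zero).clm_apply continuous_const
  have i1 : ∀ e e', Integrable (fun p => fderiv ℝ (R.indicator fun q => χ q * v q) p e' *
      fderiv ℝ (R.indicator f) p e) := fun e e' =>
    ((hc B e').mul (hc A e)).integrable_of_hasCompactSupport (As.fderiv_apply ℝ e).mul_left
  have key : ∀ p ∈ R, ∀ e e', fderiv ℝ (R.indicator fun q => χ q * v q) p e' *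
      fderiv ℝ (R.indicator f) p e = fderiv ℝ v p e' * fderiv ℝ f p e := by
    intro p hp e e'
    rw [hr_fderiv_ind hR hK.isClosed hKR h0]
    split_ifs with hk
    · congr 2
      apply Filter.EventuallyEq.fderiv_eq
      filter_upwards [hR.mem_nhds hp, hχ1.filter_mono (nhds_le_nhdsSet hk)] with q hq hq1
      simp [hq, hq1]
    · rw [hr_fderiv_out hR hK.isClosed h0 p hp hk]; simp
  have hI := ((i1 e e').sub (i1 e' e))
  have key2 : ∀ p ∈ R, (fderiv ℝ (R.indicator fun q => χ q * v q) p e' *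
      fderiv ℝ (R.indicator f) p e - fderiv ℝ (R.indicator fun q => χ q * v q) p e *
      fderiv ℝ (R.indicator f) p e') =
      fderiv ℝ v p e' * fderiv ℝ f p e - fderiv ℝ v p e * fderiv ℝ f p e' := by
    intro p hp; rw [key p hp, key p hp]
  constructor
  · exact hI.integrableOn.congr_fun key2 hR.measurableSet
  · rw [← setIntegral_congr_fun hR.measurableSet key2,
      setIntegral_eq_integral_of_forall_compl_eq_zero, integral_sub (i1 e e') (i1 e' e),
      hr_mixed B Bs A As e e', sub_self]
    intro p hp
    rw [hr_fderiv_ind hR hK.isClosed hKR h0, if_neg (fun h => hp (hKR h))]; simp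

noncomputable def hrθ (ε s : ℝ) : ℝ := min 1 (max 0 (|s| / ε - 1))
noncomputable def hrT (ε s : ℝ) : ℝ := ∫ x in (0:ℝ)..s, hrθ ε x
noncomputable def hrG (ε s : ℝ) : ℝ := ∫ x in (0:ℝ)..s, hrT ε x

lemma hrθ_cont (ε : ℝ) : Continuous (hrθ ε) := by unfold hrθ; fun_prop
lemma hrθ_nonneg (ε s : ℝ) : 0 ≤ hrθ ε s := le_min zero_le_one (le_max_left _ _)
lemma hrθ_le (ε s : ℝ) : hrθ ε s ≤ 1 := min_le_left _ _
lemma hrT_deriv (ε s : ℝ) : HasDerivAt (hrT ε) (hrθ ε s) s :=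
  (hrθ_cont ε).integral_hasStrictDerivAt 0 s |>.hasDerivAt
lemma hrT_cont (ε : ℝ) : Continuous (hrT ε) :=
  continuous_iff_continuousAt.2 fun s => (hrT_deriv ε s).continuousAt
lemma hrG_deriv (ε s : ℝ) : HasDerivAt (hrG ε) (hrT ε s) s :=
  (hrT_cont ε).integral_hasStrictDerivAt 0 s |>.hasDerivAt
lemma hrG_cont (ε : ℝ) : Continuous (hrG ε) :=
  continuous_iff_continuousAt.2 fun s => (hrG_deriv ε s).continuousAt
lemma hrT_contDiff (ε : ℝ) : ContDiff ℝ 1 (hrT ε) := by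
  rw [contDiff_one_iff_deriv]
  refine ⟨fun s => (hrT_deriv ε s).differentiableAt, ?_⟩
  rw [show deriv (hrT ε) = hrθ ε from funext fun s => (hrT_deriv ε s).deriv]
  exact hrθ_cont ε
lemma hrG_contDiff (ε : ℝ) : ContDiff ℝ 1 (hrG ε) := by
  rw [contDiff_one_iff_deriv]
  refine ⟨fun s => (hrG_deriv ε s).differentiableAt, ?_⟩
  rw [show deriv (hrG ε) = hrT ε from funext fun s => (hrG_deriv ε s).deriv]
  exact hrT_cont ε
lemma hrθ_zero {ε s : ℝ} (hε : 0 < ε) (hs : |s| ≤ ε) : hrθ ε s = 0 := by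
  have : |s| / ε - 1 ≤ 0 := by rw [sub_nonpos, div_le_one hε]; exact hs
  simp [hrθ, max_eq_left this]
lemma hr_uIcc_abs {s x : ℝ} (hx : x ∈ Set.uIcc 0 s) : |x| ≤ |s| := by
  rcases le_total 0 s with h | h
  · rw [Set.uIcc_of_le h] at hx; rw [abs_of_nonneg hx.1, abs_of_nonneg h]; exact hx.2
  · rw [Set.uIcc_of_ge h] at hx; rw [abs_of_nonpos hx.2, abs_of_nonpos h]; linarith [hx.1]
lemma hrT_zero {ε s : ℝ} (hε : 0 < ε) (hs : |s| ≤ ε) : hrT ε s = 0 := by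
  unfold hrT
  rw [intervalIntegral.integral_congr (g := fun _ => (0:ℝ))]
  · simp
  · intro x hx; exact hrθ_zero hε ((hr_uIcc_abs hx).trans hs)
lemma hrG_zero {ε s : ℝ} (hε : 0 < ε) (hs : |s| ≤ ε) : hrG ε s = 0 := by
  unfold hrG
  rw [intervalIntegral.integral_congr (g := fun _ => (0:ℝ))]
  · simp
  · intro x hx; exact hrT_zero hε ((hr_uIcc_abs hx).trans hs)
lemma hrT_mono (ε : ℝ) : Monotone (hrT ε) :=
  monotone_of_hasDerivAt_nonneg (hrT_deriv ε) (fun s => hrθ_nonneg ε s)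
lemma hrT_at_zero (ε : ℝ) : hrT ε 0 = 0 := by simp [hrT]
lemma hrG_at_zero (ε : ℝ) : hrG ε 0 = 0 := by simp [hrG]
lemma hrTG (ε s : ℝ) : hrT ε s ^ 2 ≤ 2 * hrG ε s := by
  have hd : ∀ s, HasDerivAt (fun s => 2 * hrG ε s - hrT ε s ^ 2)
      (2 * hrT ε s * (1 - hrθ ε s)) s := by
    intro s
    refine (((hrG_deriv ε s).const_mul 2).sub ((hrT_deriv ε s).pow 2)).congr_deriv ?_
    simp; ring
  have hc : Continuous (fun s => 2 * hrG ε s - hrT ε s ^ 2) :=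
    continuous_iff_continuousAt.2 fun s => (hd s).continuousAt
  have h0 : 2 * hrG ε 0 - hrT ε 0 ^ 2 = 0 := by simp [hrT_at_zero, hrG_at_zero]
  rcases le_total 0 s with h | h
  · have : MonotoneOn (fun s => 2 * hrG ε s - hrT ε s ^ 2) (Set.Ici 0) := by
      refine monotoneOn_of_deriv_nonneg (convex_Ici 0) hc.continuousOn
        (fun x _ => (hd x).differentiableAt.differentiableWithinAt) ?_
      intro x hx
      rw [(hd x).deriv]
      have h1 : 0 ≤ hrT ε x := by
        rw [← hrT_at_zero ε]; apply hrT_mono; simp at hx; exact hx.le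
      have := hrθ_le ε x
      exact mul_nonneg (by linarith) (by linarith)
    have := this (Set.self_mem_Ici) h h
    simp only at this
    linarith
  · have : AntitoneOn (fun s => 2 * hrG ε s - hrT ε s ^ 2) (Set.Iic 0) := by
      refine antitoneOn_of_deriv_nonpos (convex_Iic 0) hc.continuousOn
        (fun x _ => (hd x).differentiableAt.differentiableWithinAt) ?_
      intro x hx
      rw [(hd x).deriv]
      have h1 : hrT ε x ≤ 0 := by
        rw [← hrT_at_zero ε]; apply hrT_mono; simp at hx; exact hx.le
      have := hrθ_le ε x
      exact mul_nonpos_of_nonpos_of_nonneg (by linarith) (by linarith)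
    have := this h (Set.self_mem_Iic) h
    simp only at this
    linarith
lemma hrθ_tendsto {s : ℝ} (hs : s ≠ 0) :
    Tendsto (fun n : ℕ => hrθ (1 / ((n:ℝ) + 1)) s) atTop (𝓝 1) := by
  have h1 : Tendsto (fun n : ℕ => |s| * ((n:ℝ) + 1)) atTop atTop :=
    Tendsto.const_mul_atTop (abs_pos.2 hs)
      (tendsto_atTop_add_const_right _ _ tendsto_natCast_atTop_atTop)
  refine tendsto_const_nhds.congr' ?_
  filter_upwards [h1.eventually_ge_atTop 2] with n hn
  unfold hrθ
  rw [div_div_eq_mul_div, div_one, max_eq_right (by linarith), min_eq_left (by linarith)]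

lemma hr_alg (γ P Q S θ T G ux uy vx vy wx wy : ℝ) (hγ0 : 0 ≤ γ) (hγ1 : γ < 1)
    (hP : 0 < P) (hS : 0 ≤ S) (hPS : P * S = Q ^ 2) (hθ0 : 0 ≤ θ) (hθ1 : θ ≤ 1)
    (hTG : T ^ 2 ≤ 2 * G) :
    P * (θ * wx ^ 2) / 2 ≤ 1 / (1 - γ) * (P * (ux ^ 2 + vy ^ 2 + 2 * ((uy + vx) / 2) ^ 2))
      + (vy * (P * θ * wx) - vx * (γ * Q * T + P * θ * wy))
      - ((P * θ * wx) * (ux - wx) + (γ * Q * T + P * θ * wy) * (uy - wy))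
      - γ * ((γ - 1) * S * G + Q * T * wy) := by
  set r := 1 - γ with hr
  have hr0 : 0 < r := by linarith
  set m := uy + vx with hm
  set E := ux ^ 2 + vy ^ 2 + 2 * (m / 2) ^ 2 with hE
  have hE0 : 0 ≤ E := by positivity
  have hmE : m ^ 2 ≤ 2 * E := by rw [hE]; nlinarith [sq_nonneg ux, sq_nonneg vy]
  have b1 : (ux - vy) * wx + m * wy ≤ (wx ^ 2 + wy ^ 2) / 2 + E := by
    rw [hE]; nlinarith [sq_nonneg (ux - vy - wx), sq_nonneg (m - wy), sq_nonneg (ux + vy)]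
  have b2 : P * θ * ((ux - vy) * wx + m * wy) ≤ P * θ * ((wx ^ 2 + wy ^ 2) / 2) + P * E := by
    have := mul_le_mul_of_nonneg_left b1 (mul_nonneg hP.le hθ0)
    have h2 : P * θ * E ≤ P * E := by
      have : P * E * θ ≤ P * E * 1 := mul_le_mul_of_nonneg_left hθ1 (mul_nonneg hP.le hE0)
      linarith
    linarith
  have b3 : m * Q * T ≤ r * S * G + P * E / r := by
    have h1 : m * Q * T ≤ r * S * T ^ 2 / 2 + P * m ^ 2 / (2 * r) := by
      have h : r * S * T ^ 2 / 2 + P * m ^ 2 / (2 * r) - m * Q * T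
          = (r * Q * T - P * m) ^ 2 / (2 * r * P) := by
        field_simp
        linear_combination (r ^ 2 * T ^ 2) * hPS
      have : 0 ≤ (r * Q * T - P * m) ^ 2 / (2 * r * P) := by positivity
      linarith
    have h2 : r * S * T ^ 2 / 2 ≤ r * S * G := by
      have := mul_le_mul_of_nonneg_left hTG (mul_nonneg hr0.le hS)
      linarith
    have h3 : P * m ^ 2 / (2 * r) ≤ P * E / r := by
      rw [div_le_div_iff₀ (by positivity) hr0]
      have := mul_le_mul_of_nonneg_left hmE (mul_nonneg hP.le hr0.le)
      nlinarith
    linarith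
  have b4 := mul_le_mul_of_nonneg_left b3 hγ0
  have b5 : 1 / r * (P * E) = P * E + γ * (P * E / r) := by
    field_simp; rw [hr]; ring
  have b6 : 0 ≤ P * θ * wy ^ 2 := by positivity
  rw [b5]
  have hγr : γ - 1 = - r := by rw [hr]; ring
  rw [hγr]
  have hvx : vx = m - uy := by rw [hm]; ring
  rw [hvx]
  linarith

lemma hr_energy (α ε : ℝ) (hα : α ∈ Set.Ico (0 : ℝ) (1 / 2)) (hε : 0 < ε)
    (U : ℝ × ℝ → ℝ × ℝ) (ut : ℝ × ℝ → ℝ) (R K : Set (ℝ × ℝ)) (hRo : IsOpen R)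
    (hRp : ∀ p ∈ R, 0 < p.2)
    (hU : ContDiffOn ℝ 1 U R) (hutd : ContDiffOn ℝ 2 ut R)
    (hharm : ∀ p ∈ R, lap ut p = 0)
    (hK : IsCompact K) (hKR : K ⊆ R) (hKw : ∀ p ∈ R, p ∉ K → |(U p).1 - ut p| ≤ ε)
    (hS : IntegrableOn (fun p => p.2 ^ (2 * α) * strainNormSq U p) R) :
    IntegrableOn (fun p => p.2 ^ (2 * α) * (hrθ ε ((U p).1 - ut p) *
      (d₁ (fun q => (U q).1 - ut q) p) ^ 2)) R ∧
    ∫ p in R, p.2 ^ (2 * α) * (hrθ ε ((U p).1 - ut p) *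
      (d₁ (fun q => (U q).1 - ut q) p) ^ 2) ≤
      2 / (1 - 2 * α) * ∫ p in R, p.2 ^ (2 * α) * strainNormSq U p := by
  obtain ⟨hα0, hα1⟩ := hα
  set γ := 2 * α with hγ
  have hγ0 : 0 ≤ γ := by linarith
  have hγ1 : γ < 1 := by linarith
  set w : ℝ × ℝ → ℝ := fun q => (U q).1 - ut q with hw
  have hu : ContDiffOn ℝ 1 (fun q => (U q).1) R := hU.fst
  have hv : ContDiffOn ℝ 1 (fun q => (U q).2) R := hU.snd
  have hut1 : ContDiffOn ℝ 1 ut R := hutd.of_le (by norm_num)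
  have hwc : ContDiffOn ℝ 1 w R := hu.sub hut1
  have hpow : ∀ β : ℝ, ContDiffOn ℝ 1 (fun p : ℝ × ℝ => p.2 ^ β) R := fun β =>
    contDiffOn_snd.rpow_const_of_ne (fun p hp => (hRp p hp).ne')
  set φ : ℝ × ℝ → ℝ := fun p => p.2 ^ γ * hrT ε (w p) with hφd
  set ψ : ℝ × ℝ → ℝ := fun p => p.2 ^ (γ - 1) * hrG ε (w p) with hψd
  have hφ : ContDiffOn ℝ 1 φ R := (hpow _).mul ((hrT_contDiff ε).comp_contDiffOn hwc)
  have hψ : ContDiffOn ℝ 1 ψ R := (hpow _).mul ((hrG_contDiff ε).comp_contDiffOn hwc)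
  have hφ0 : ∀ p ∈ R, p ∉ K → φ p = 0 := fun p hp hk => by
    have h1 : hrT ε (w p) = 0 := hrT_zero hε (hKw p hp hk)
    simp [hφd, h1]
  have hψ0 : ∀ p ∈ R, p ∉ K → ψ p = 0 := fun p hp hk => by
    have h1 : hrG ε (w p) = 0 := hrG_zero hε (hKw p hp hk)
    simp [hψd, h1]
  have hdut : ∀ e : ℝ × ℝ, ContDiffOn ℝ 1 (fun p => fderiv ℝ ut p e) R := fun e =>
    (hutd.fderiv_of_isOpen hRo (by norm_num)).clm_apply contDiffOn_const
  obtain ⟨i1, z1⟩ := hr_int_zero_on hRo hK hKR (hφ.mul (hdut (1,0)))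
    (fun p hp hk => by simp [hφ0 p hp hk]) (1,0)
  obtain ⟨i2, z2⟩ := hr_int_zero_on hRo hK hKR (hφ.mul (hdut (0,1)))
    (fun p hp hk => by simp [hφ0 p hp hk]) (0,1)
  obtain ⟨i3, z3⟩ := hr_int_zero_on hRo hK hKR hψ hψ0 (0,1)
  obtain ⟨i4, z4⟩ := hr_mixed_on hRo hK hKR hφ hφ0 hv (1,0) (0,1)
  set g : ℝ × ℝ → ℝ := fun p => 1 / (1 - γ) * (p.2 ^ γ * strainNormSq U p)
    + (fderiv ℝ (fun q => (U q).2) p (0,1) * fderiv ℝ φ p (1,0)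
      - fderiv ℝ (fun q => (U q).2) p (1,0) * fderiv ℝ φ p (0,1))
    - (fderiv ℝ (fun q => φ q * fderiv ℝ ut q (1,0)) p (1,0) +
        fderiv ℝ (fun q => φ q * fderiv ℝ ut q (0,1)) p (0,1))
    - γ * fderiv ℝ ψ p (0,1) with hg
  have hgi : IntegrableOn g R :=
    (((hS.const_mul _).add i4).sub (i1.add i2)).sub (i3.const_mul γ)
  have hgz : ∫ p in R, g p = 1 / (1 - γ) * ∫ p in R, p.2 ^ γ * strainNormSq U p := by
    rw [hg, integral_sub, integral_sub, integral_add, integral_add, z1, z2, z4,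
      integral_const_mul, integral_const_mul, z3]
    · ring
    · exact i1
    · exact i2
    · exact hS.const_mul _
    · exact i4
    · exact (hS.const_mul _).add i4
    · exact i1.add i2
    · exact ((hS.const_mul _).add i4).sub (i1.add i2)
    · exact i3.const_mul γ
  have hpt : ∀ p ∈ R, p.2 ^ γ * (hrθ ε (w p) * (d₁ w p) ^ 2) / 2 ≤ g p := by
    intro p hp
    have hy := hRp p hp
    have hn := hRo.mem_nhds hp
    have du := ((hu.contDiffAt hn).differentiableAt one_ne_zero)
    have dut := ((hut1.contDiffAt hn).differentiableAt one_ne_zero)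
    have dw := ((hwc.contDiffAt hn).differentiableAt one_ne_zero)
    have dφ := ((hφ.contDiffAt hn).differentiableAt one_ne_zero)
    have ddut := fun e => (((hdut e).contDiffAt hn).differentiableAt one_ne_zero)
    have dpow : ∀ β : ℝ, HasFDerivAt (fun p : ℝ × ℝ => p.2 ^ β)
      ((β * p.2 ^ (β - 1)) • ContinuousLinearMap.snd ℝ ℝ ℝ) p := fun β =>
      hasFDerivAt_snd.rpow_const (Or.inl hy.ne')
    have e1 : ∀ e : ℝ × ℝ, fderiv ℝ φ p e = γ * p.2 ^ (γ - 1) * hrT ε (w p) * e.2 +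
        p.2 ^ γ * hrθ ε (w p) * fderiv ℝ w p e := by
      intro e
      have := (dpow γ).mul ((hrT_deriv ε (w p)).comp_hasFDerivAt p dw.hasFDerivAt)
      have h2 : fderiv ℝ φ p = _ := this.fderiv
      rw [h2]; simp; ring
    have e2 : ∀ e : ℝ × ℝ, fderiv ℝ ψ p e = (γ - 1) * p.2 ^ (γ - 1 - 1) * hrG ε (w p) * e.2 +
        p.2 ^ (γ - 1) * hrT ε (w p) * fderiv ℝ w p e := by
      intro e
      have := (dpow (γ - 1)).mul ((hrG_deriv ε (w p)).comp_hasFDerivAt p dw.hasFDerivAt)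
      have h2 : fderiv ℝ ψ p = _ := this.fderiv
      rw [h2]; simp; ring
    have e3 : ∀ e e' : ℝ × ℝ, fderiv ℝ (fun q => φ q * fderiv ℝ ut q e) p e' =
        fderiv ℝ φ p e' * fderiv ℝ ut p e + φ p * fderiv ℝ (fun q => fderiv ℝ ut q e) p e' := by
      intro e e'
      have := dφ.hasFDerivAt.mul (ddut e).hasFDerivAt
      have h2 : fderiv ℝ (fun q => φ q * fderiv ℝ ut q e) p = _ := this.fderiv
      rw [h2]; simp; ring
    have e4 : ∀ e : ℝ × ℝ, fderiv ℝ ut p e = fderiv ℝ (fun q => (U q).1) p e - fderiv ℝ w p e := by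
      intro e
      have := (du.hasFDerivAt.sub dut.hasFDerivAt)
      have h2 : fderiv ℝ w p = _ := this.fderiv
      rw [h2]; simp
    have hl := hharm p hp
    simp only [lap, d₁, d₂] at hl
    have key := hr_alg γ (p.2 ^ γ) (p.2 ^ (γ - 1)) (p.2 ^ (γ - 1 - 1)) (hrθ ε (w p))
      (hrT ε (w p)) (hrG ε (w p)) (fderiv ℝ (fun q => (U q).1) p (1,0))
      (fderiv ℝ (fun q => (U q).1) p (0,1)) (fderiv ℝ (fun q => (U q).2) p (1,0))
      (fderiv ℝ (fun q => (U q).2) p (0,1)) (fderiv ℝ w p (1,0)) (fderiv ℝ w p (0,1))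
      hγ0 hγ1 (by positivity) (by positivity)
      (by rw [sq, ← Real.rpow_add hy, ← Real.rpow_add hy]; congr 1; ring)
      (hrθ_nonneg _ _) (hrθ_le _ _) (hrTG _ _)
    refine key.trans (le_of_eq ?_)
    simp only [hg, strainNormSq, d₁, d₂, e3, e2]
    rw [e4, e4, e1, e1]
    simp only
    linear_combination (φ p) * hl
  have hae : ∀ᵐ p ∂(volume.restrict R), p.2 ^ γ * (hrθ ε (w p) * (d₁ w p) ^ 2) ≤ 2 * g p := by
    filter_upwards [ae_restrict_mem hRo.measurableSet] with p hp
    linarith [hpt p hp]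
  have hnn : ∀ᵐ p ∂(volume.restrict R), 0 ≤ p.2 ^ γ * (hrθ ε (w p) * (d₁ w p) ^ 2) := by
    filter_upwards [ae_restrict_mem hRo.measurableSet] with p hp
    have := hRp p hp
    have := hrθ_nonneg ε (w p)
    positivity
  constructor
  · refine Integrable.mono' (hgi.const_mul 2) ?_ ?_
    · refine ContinuousOn.aestronglyMeasurable ?_ hRo.measurableSet
      refine (hpow γ).continuousOn.mul (((hrθ_cont ε).comp_continuousOn hwc.continuousOn).mul ?_)
      refine ContinuousOn.pow ?_ 2
      exact (hwc.continuousOn_fderiv_of_isOpen hRo le_rfl).clm_apply continuousOn_const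
    · filter_upwards [hae, hnn] with p h1 h2
      rw [Real.norm_of_nonneg h2]; exact h1
  · refine (integral_mono_of_nonneg hnn (hgi.const_mul 2) hae).trans (le_of_eq ?_)
    rw [integral_const_mul, hgz]; ring

lemma hr_poincare1 (h : ℝ) (hh : 0 < h) (f f' : ℝ → ℝ) (hf : ContinuousOn f (Set.Icc 0 h))
    (hf0 : f 0 = 0) (hd : ∀ x ∈ Set.Ioo 0 h, HasDerivAt f (f' x) x) (hm : Measurable f')
    (hi : IntegrableOn (fun x => f' x ^ 2) (Set.Ioo 0 h)) :
    ∫ x in Set.Ioo 0 h, f x ^ 2 ≤ h ^ 2 * ∫ x in Set.Ioo 0 h, f' x ^ 2 := by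
  have hi1 : IntegrableOn f' (Set.Ioo 0 h) :=
    ((memLp_two_iff_integrable_sq hm.aestronglyMeasurable).2 hi).integrable one_le_two
  set A := ∫ x in Set.Ioo 0 h, f' x ^ 2 with hA
  have hA0 : 0 ≤ A := integral_nonneg fun x => sq_nonneg _
  have hpt : ∀ x ∈ Set.Ioo 0 h, f x ^ 2 ≤ h * A := by
    intro x hx
    have hsub : Set.Ioc 0 x ⊆ Set.Ioo 0 h := fun y hy => ⟨hy.1, hy.2.trans_lt hx.2⟩
    have hint : IntegrableOn f' (Set.Ioc 0 x) := hi1.mono_set hsub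
    have hint2 : IntegrableOn (fun x => f' x ^ 2) (Set.Ioc 0 x) := hi.mono_set hsub
    have hftc : ∫ y in Set.Ioc 0 x, f' y = f x := by
      rw [← intervalIntegral.integral_of_le hx.1.le,
        intervalIntegral.integral_eq_sub_of_hasDerivAt_of_le hx.1.le
          (hf.mono (Set.Icc_subset_Icc_right hx.2.le))
          (fun y hy => hd y ⟨hy.1, hy.2.trans hx.2⟩)
          ((intervalIntegrable_iff_integrableOn_Ioc_of_le hx.1.le).2 hint), hf0, sub_zero]
    set B := ∫ y in Set.Ioc 0 x, f' y ^ 2 with hB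
    have hBA : B ≤ A :=
      setIntegral_mono_set hi (Eventually.of_forall fun x => sq_nonneg _) hsub.eventuallyLE
    have hx0 : 0 < x := hx.1
    have hcs : 0 ≤ ∫ y in Set.Ioc 0 x, (f' y ^ 2 - 2 * (f x / x) * f' y + (f x / x) ^ 2) := by
      refine integral_nonneg fun y => ?_
      have := sq_nonneg (f' y - f x / x)
      simp only [Pi.zero_apply]
      linarith
    have hi3 : IntegrableOn (fun y => f' y ^ 2 - 2 * (f x / x) * f' y) (Set.Ioc 0 x) :=
      hint2.sub (hint.const_mul _)
    rw [integral_add hi3 (integrable_const _),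
      integral_sub hint2 (hint.const_mul _), integral_const_mul, hftc] at hcs
    simp only [integral_const, MeasurableSet.univ, measureReal_restrict_apply, Set.univ_inter,
      Real.volume_real_Ioc_of_le hx0.le, sub_zero, smul_eq_mul] at hcs
    have h2 : B - 2 * (f x / x) * f x + x * (f x / x) ^ 2 = B - f x ^ 2 / x := by
      field_simp; ring
    rw [h2] at hcs
    have h3 : f x ^ 2 ≤ B * x := by
      rw [sub_nonneg, div_le_iff₀ hx0] at hcs; exact hcs
    have hxh := hx.2
    nlinarith [mul_le_mul_of_nonneg_right hBA hx0.le, mul_le_mul_of_nonneg_left hxh.le hA0]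
  have hle : ∫ x in Set.Ioo 0 h, f x ^ 2 ≤ ∫ x in Set.Ioo 0 h, h * A := by
    refine integral_mono_of_nonneg (Eventually.of_forall fun x => sq_nonneg _) (integrable_const _) ?_
    filter_upwards [ae_restrict_mem measurableSet_Ioo] with x hx using hpt x hx
  refine hle.trans (le_of_eq ?_)
  simp [Real.volume_real_Ioo_of_le hh.le]
  ring

lemma hr_restrict_prod (s t : Set ℝ) :
    (volume : Measure (ℝ × ℝ)).restrict (s ×ˢ t) = (volume.restrict s).prod (volume.restrict t) := by
  rw [Measure.prod_restrict, Measure.volume_eq_prod]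

lemma hr_poincare2 (a h γ : ℝ) (hh : 0 < h) (hγ : 0 ≤ γ) (w : ℝ × ℝ → ℝ)
    (hwc : ContinuousOn w (Set.Icc 0 h ×ˢ Set.Icc 0 a))
    (hwd : DifferentiableOn ℝ w (Set.Ioo 0 h ×ˢ Set.Ioo 0 a))
    (hw0 : ∀ y ∈ Set.Ioo 0 a, w (0, y) = 0)
    (hi : IntegrableOn (fun p => p.2 ^ γ * d₁ w p ^ 2) (Set.Ioo 0 h ×ˢ Set.Ioo 0 a)) :
    ∫ p in Set.Ioo 0 h ×ˢ Set.Ioo 0 a, p.2 ^ γ * w p ^ 2 ≤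
      h ^ 2 * ∫ p in Set.Ioo 0 h ×ˢ Set.Ioo 0 a, p.2 ^ γ * d₁ w p ^ 2 := by
  have hi2 : IntegrableOn (fun p => p.2 ^ γ * w p ^ 2) (Set.Ioo 0 h ×ˢ Set.Ioo 0 a) := by
    refine IntegrableOn.mono_set (ContinuousOn.integrableOn_compact
      (isCompact_Icc.prod isCompact_Icc) ?_) (Set.prod_mono Set.Ioo_subset_Icc_self
        Set.Ioo_subset_Icc_self)
    exact (continuousOn_snd.rpow_const fun _ _ => Or.inr hγ).mul (hwc.pow 2)
  unfold IntegrableOn at hi hi2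
  rw [hr_restrict_prod] at *
  rw [integral_prod_symm _ hi, integral_prod_symm _ hi2, ← integral_const_mul]
  refine integral_mono_ae hi2.integral_prod_right (hi.integral_prod_right.const_mul _) ?_
  filter_upwards [hi.prod_left_ae, ae_restrict_mem measurableSet_Ioo] with y hy hya
  rw [integral_const_mul, integral_const_mul]
  have hyp : 0 < y ^ γ := Real.rpow_pos_of_pos hya.1 _
  have hy' : Integrable (fun x => d₁ w (x, y) ^ 2) (volume.restrict (Set.Ioo 0 h)) := by
    have := hy.const_mul (y ^ γ)⁻¹
    refine this.congr (Eventually.of_forall fun x => ?_)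
    simp only
    field_simp
  have := hr_poincare1 h hh (fun x => w (x, y)) (fun x => d₁ w (x, y))
    (hwc.comp (by fun_prop) (fun x hx => ⟨hx, Set.Ioo_subset_Icc_self hya⟩)) (hw0 y hya)
    (fun x hx => by
      have hd : DifferentiableAt ℝ w (x, y) :=
        hwd.differentiableAt ((isOpen_Ioo.prod isOpen_Ioo).mem_nhds ⟨hx, hya⟩)
      have hl : HasDerivAt (fun x : ℝ => (x, y)) ((1:ℝ), (0:ℝ)) x :=
        (hasDerivAt_id x).prodMk (hasDerivAt_const x y)
      exact hd.hasFDerivAt.comp_hasDerivAt x hl)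
    ((measurable_fderiv_apply_const ℝ w (1,0)).comp (by fun_prop)) hy'
  nlinarith [mul_le_mul_of_nonneg_left this hyp.le]

lemma hr_null (a h : ℝ) (w : ℝ × ℝ → ℝ)
    (hwc : ContinuousOn w (Set.Icc 0 h ×ˢ Set.Icc 0 a))
    (hwd : DifferentiableOn ℝ w (Set.Ioo 0 h ×ˢ Set.Ioo 0 a)) :
    ∀ᵐ p ∂(volume.restrict (Set.Ioo 0 h ×ˢ Set.Ioo 0 a)), w p = 0 → d₁ w p = 0 := by
  have hRo : IsOpen (Set.Ioo 0 h ×ˢ Set.Ioo 0 a) := isOpen_Ioo.prod isOpen_Ioo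
  rw [ae_restrict_iff' hRo.measurableSet, ae_iff]
  set N : Set (ℝ × ℝ) := (Set.Ioo 0 h ×ˢ Set.Ioo 0 a) ∩
    ((Set.Icc 0 h ×ˢ Set.Icc 0 a) ∩ w ⁻¹' {0}) ∩ (d₁ w ⁻¹' {0})ᶜ with hN
  have hNm : MeasurableSet N := by
    refine (hRo.measurableSet.inter ?_).inter ?_
    · exact (hwc.preimage_isClosed_of_isClosed (isClosed_Icc.prod isClosed_Icc)
        isClosed_singleton).measurableSet
    · exact ((measurable_fderiv_apply_const ℝ w (1,0)) (measurableSet_singleton 0)).compl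
  refine measure_mono_null (t := N) ?_ ?_
  · rintro p hp
    simp only [Set.mem_ofPred_eq, Classical.not_imp] at hp
    exact ⟨⟨hp.1, Set.prod_mono Set.Ioo_subset_Icc_self Set.Ioo_subset_Icc_self hp.1, hp.2.1⟩,
      hp.2.2⟩
  · rw [Measure.volume_eq_prod, Measure.prod_apply_symm hNm]
    rw [lintegral_eq_zero_iff (measurable_measure_prodMk_right hNm)]
    refine Eventually.of_forall fun y => ?_
    refine Set.Countable.measure_zero ?_ _
    set M := (fun x : ℝ => (x, y)) ⁻¹' N
    have hdisc : DiscreteTopology M := by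
      rw [discreteTopology_subtype_iff]
      rintro x ⟨⟨hxR, hx2⟩, hx3⟩
      have hd : DifferentiableAt ℝ w (x, y) := hwd.differentiableAt (hRo.mem_nhds hxR)
      have hl : HasDerivAt (fun x : ℝ => (x, y)) ((1:ℝ), (0:ℝ)) x :=
        (hasDerivAt_id x).prodMk (hasDerivAt_const x y)
      have h1 : HasDerivAt (fun x => w (x, y)) (d₁ w (x, y)) x :=
        hd.hasFDerivAt.comp_hasDerivAt x hl
      have h2 := h1.eventually_ne (c := 0) hx3
      rw [← Filter.empty_mem_iff_bot, Filter.mem_inf_principal]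
      filter_upwards [h2] with z hz hzM
      exact hz hzM.1.2.2
    exact Set.countable_coe_iff.1 (TopologicalSpace.separableSpace_iff_countable.1 inferInstance)

lemma hr_strain_int (a h γ : ℝ) (ha : 0 < a) (hh : 0 < h) (hγ : 0 ≤ γ) (U : ℝ × ℝ → ℝ × ℝ)
    (hU : ContDiffOn ℝ 1 U (Set.Icc 0 h ×ˢ Set.Icc 0 a)) :
    IntegrableOn (fun p => p.2 ^ γ * strainNormSq U p) (Set.Ioo 0 h ×ˢ Set.Ioo 0 a) := by
  set C := Set.Icc 0 h ×ˢ Set.Icc 0 a with hC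
  set R := Set.Ioo 0 h ×ˢ Set.Ioo 0 a with hR
  have hRo : IsOpen R := isOpen_Ioo.prod isOpen_Ioo
  have hRC : R ⊆ C := Set.prod_mono Set.Ioo_subset_Icc_self Set.Ioo_subset_Icc_self
  have huC : UniqueDiffOn ℝ C := (uniqueDiffOn_Icc hh).prod (uniqueDiffOn_Icc ha)
  have hD := hU.continuousOn_fderivWithin huC le_rfl
  have hDe : ∀ e : ℝ × ℝ, ContinuousOn (fun p => fderivWithin ℝ U C p e) C := fun e =>
    hD.clm_apply continuousOn_const
  have hI : IntegrableOn (fun p => p.2 ^ γ * ((fderivWithin ℝ U C p (1,0)).1 ^ 2 +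
      (fderivWithin ℝ U C p (0,1)).2 ^ 2 + 2 * (((fderivWithin ℝ U C p (0,1)).1 +
      (fderivWithin ℝ U C p (1,0)).2) / 2) ^ 2)) C := by
    refine ContinuousOn.integrableOn_compact (isCompact_Icc.prod isCompact_Icc) ?_
    refine (continuousOn_snd.rpow_const fun _ _ => Or.inr hγ).mul ?_
    exact (((hDe _).fst.pow 2).add ((hDe _).snd.pow 2)).add
      (((((hDe _).fst.add (hDe _).snd).div_const 2).pow 2).const_mul 2)
  refine (hI.mono_set hRC).congr_fun ?_ hRo.measurableSet
  intro p hp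
  have hn : C ∈ 𝓝 p := Filter.mem_of_superset (hRo.mem_nhds hp) hRC
  have hd : DifferentiableAt ℝ U p := (hU.contDiffAt hn).differentiableAt one_ne_zero
  have h1 : ∀ e, fderiv ℝ (fun q => (U q).1) p e = (fderiv ℝ U p e).1 := fun e => by
    rw [show fderiv ℝ (fun q => (U q).1) p = _ from hd.hasFDerivAt.fst.fderiv]; rfl
  have h2 : ∀ e, fderiv ℝ (fun q => (U q).2) p e = (fderiv ℝ U p e).2 := fun e => by
    rw [show fderiv ℝ (fun q => (U q).2) p = _ from hd.hasFDerivAt.snd.fderiv]; rfl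
  simp only [strainNormSq, d₁, d₂, h1, h2, fderivWithin_of_mem_nhds hn]

lemma hr_limit {R : Set (ℝ × ℝ)} (hRm : MeasurableSet R) (F : ℝ × ℝ → ℝ)
    (Fn : ℕ → ℝ × ℝ → ℝ) (C : ℝ) (hF : AEStronglyMeasurable F (volume.restrict R))
    (hF0 : ∀ p ∈ R, 0 ≤ F p) (hFn0 : ∀ n, ∀ p ∈ R, 0 ≤ Fn n p)
    (hi : ∀ n, IntegrableOn (Fn n) R) (hb : ∀ n, ∫ p in R, Fn n p ≤ C)
    (hlim : ∀ᵐ p ∂(volume.restrict R), Tendsto (fun n => Fn n p) atTop (𝓝 (F p))) :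
    IntegrableOn F R ∧ ∫ p in R, F p ≤ C := by
  have hF0' : 0 ≤ᵐ[volume.restrict R] F := by
    filter_upwards [ae_restrict_mem hRm] with p hp using hF0 p hp
  have hFn0' : ∀ n, 0 ≤ᵐ[volume.restrict R] Fn n := fun n => by
    filter_upwards [ae_restrict_mem hRm] with p hp using hFn0 n p hp
  have hC : 0 ≤ C := (integral_nonneg_of_ae (hFn0' 0)).trans (hb 0)
  have key : ∫⁻ p in R, ENNReal.ofReal (F p) ≤ ENNReal.ofReal C := by
    calc ∫⁻ p in R, ENNReal.ofReal (F p)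
        = ∫⁻ p in R, liminf (fun n => ENNReal.ofReal (Fn n p)) atTop := by
          refine lintegral_congr_ae ?_
          filter_upwards [hlim] with p hp
          exact ((ENNReal.tendsto_ofReal hp).liminf_eq).symm
      _ ≤ liminf (fun n => ∫⁻ p in R, ENNReal.ofReal (Fn n p)) atTop :=
          lintegral_liminf_le' fun n => (hi n).aestronglyMeasurable.aemeasurable.ennreal_ofReal
      _ ≤ ENNReal.ofReal C := by
          refine (liminf_le_liminf (v := fun _ => ENNReal.ofReal C)
            (Eventually.of_forall fun n => ?_)).trans_eq (by simp)
          rw [← ofReal_integral_eq_lintegral_ofReal (hi n) (hFn0' n)]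
          exact ENNReal.ofReal_le_ofReal (hb n)
  constructor
  · refine ⟨hF, ?_⟩
    rw [hasFiniteIntegral_iff_ofReal hF0']
    exact key.trans_lt ENNReal.ofReal_lt_top
  · rw [integral_eq_lintegral_of_nonneg_ae hF0' hF]
    exact ENNReal.toReal_le_of_le_ofReal hC key

/-- **Estimate (4.32)** in the proof of Theorem 2.2 (weighted Poincaré bound for the
harmonic replacement).  On `R = (0,h) × (0,a)`, with `γ = 2α`, `α ∈ [0,1/2)`,
`𝐔 = (u,v) ∈ C¹(R̄,ℝ²) ∩ H¹(R,ℝ²)` and `ũ` the harmonic function in `R` with `ũ = u`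
on `∂R`, one has
`‖y^α (u - ũ)‖ ≤ h ‖y^α (u - ũ)_x‖ ≤ (4h/(1-γ)) ‖y^α e(𝐔)‖`. -/
theorem harmonic_replacement_poincare_bound
    (a h : ℝ) (ha : 0 < a) (hh : 0 < h) (α : ℝ) (hα : α ∈ Set.Ico (0 : ℝ) (1 / 2))
    (U : ℝ × ℝ → ℝ × ℝ) (ut : ℝ × ℝ → ℝ)
    -- 𝐔 ∈ C¹(R̄, ℝ²) ∩ H¹(R, ℝ²)
    (hU : ContDiffOn ℝ 1 U (closure (Set.Ioo 0 h ×ˢ Set.Ioo 0 a)))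
    -- ũ is the solution of the Dirichlet problem: harmonic in R with trace u on ∂R
    (hutc : ContinuousOn ut (closure (Set.Ioo 0 h ×ˢ Set.Ioo 0 a)))
    (hutd : ContDiffOn ℝ 2 ut (Set.Ioo 0 h ×ˢ Set.Ioo 0 a))
    (hharm : ∀ p ∈ Set.Ioo 0 h ×ˢ Set.Ioo 0 a, lap ut p = 0)
    (hbd : ∀ p ∈ frontier (Set.Ioo 0 h ×ˢ Set.Ioo 0 a), ut p = (U p).1) :
    Real.sqrt (∫ p in Set.Ioo 0 h ×ˢ Set.Ioo 0 a,
        (p.2 ^ α) ^ 2 * ((U p).1 - ut p) ^ 2) ≤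
      h * Real.sqrt (∫ p in Set.Ioo 0 h ×ˢ Set.Ioo 0 a,
        (p.2 ^ α) ^ 2 * (d₁ (fun q => (U q).1 - ut q) p) ^ 2) ∧
    h * Real.sqrt (∫ p in Set.Ioo 0 h ×ˢ Set.Ioo 0 a,
        (p.2 ^ α) ^ 2 * (d₁ (fun q => (U q).1 - ut q) p) ^ 2) ≤
      4 * h / (1 - 2 * α) *
        Real.sqrt (∫ p in Set.Ioo 0 h ×ˢ Set.Ioo 0 a,
          (p.2 ^ α) ^ 2 * strainNormSq U p) := by
  have hα0 := hα.1
  have hα1 := hα.2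
  have hcl : closure (Set.Ioo 0 h ×ˢ Set.Ioo 0 a) = Set.Icc 0 h ×ˢ Set.Icc 0 a := by
    rw [closure_prod_eq, closure_Ioo hh.ne, closure_Ioo ha.ne]
  have hRo : IsOpen (Set.Ioo 0 h ×ˢ Set.Ioo 0 a) := isOpen_Ioo.prod isOpen_Ioo
  have hRC : Set.Ioo 0 h ×ˢ Set.Ioo 0 a ⊆ Set.Icc 0 h ×ˢ Set.Icc 0 a :=
    Set.prod_mono Set.Ioo_subset_Icc_self Set.Ioo_subset_Icc_self
  have hfr : ∀ p ∈ Set.Icc 0 h ×ˢ Set.Icc 0 a, p ∉ Set.Ioo 0 h ×ˢ Set.Ioo 0 a →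
      (U p).1 - ut p = 0 := by
    intro p hp hp'
    rw [hbd p (by rw [hRo.frontier_eq, hcl]; exact ⟨hp, hp'⟩), sub_self]
  rw [hcl] at hU hutc
  clear hbd hcl
  have hsq : ∀ p ∈ Set.Ioo 0 h ×ˢ Set.Ioo 0 a, (p.2 ^ α) ^ 2 = p.2 ^ (2 * α) := by
    intro p hp
    rw [mul_comm, Real.rpow_mul hp.2.1.le]; norm_cast
  have hcg : ∀ f : ℝ × ℝ → ℝ, ∫ p in Set.Ioo 0 h ×ˢ Set.Ioo 0 a, (p.2 ^ α) ^ 2 * f p =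
      ∫ p in Set.Ioo 0 h ×ˢ Set.Ioo 0 a, p.2 ^ (2 * α) * f p := fun f =>
    setIntegral_congr_fun hRo.measurableSet (fun p hp => by simp only [hsq p hp])
  rw [hcg (fun p => ((U p).1 - ut p) ^ 2), hcg (fun p => (d₁ (fun q => (U q).1 - ut q) p) ^ 2),
    hcg (fun p => strainNormSq U p)]
  clear hcg
  set R := Set.Ioo 0 h ×ˢ Set.Ioo 0 a with hR
  have hUR : ContDiffOn ℝ 1 U R := hU.mono hRC
  have hwc : ContinuousOn (fun q => (U q).1 - ut q) (Set.Icc 0 h ×ˢ Set.Icc 0 a) :=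
    hU.continuousOn.fst.sub hutc
  have hw1 : ContDiffOn ℝ 1 (fun q => (U q).1 - ut q) R :=
    hUR.fst.sub (hutd.of_le (by norm_num))
  have hwd := hw1.differentiableOn one_ne_zero
  have hS := hr_strain_int a h (2 * α) ha hh (by linarith) U hU
  have hen : ∀ n : ℕ, _ := fun n => hr_energy α (1 / ((n:ℝ) + 1)) hα (by positivity) U ut R
    ((Set.Icc 0 h ×ˢ Set.Icc 0 a) ∩ (fun q => |(U q).1 - ut q|) ⁻¹' (Set.Ici (1 / ((n:ℝ) + 1))))
    hRo (fun p hp => hp.2.1) hUR hutd hharm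
    ((isCompact_Icc.prod isCompact_Icc).of_isClosed_subset
      (hwc.abs.preimage_isClosed_of_isClosed (isClosed_Icc.prod isClosed_Icc) isClosed_Ici)
      Set.inter_subset_left)
    (fun p hp => by
      by_contra hpR
      have h0 := hfr p hp.1 hpR
      have h1 : 1 / ((n:ℝ) + 1) ≤ |(U p).1 - ut p| := hp.2
      rw [h0, abs_zero] at h1
      have : 0 < 1 / ((n:ℝ) + 1) := by positivity
      linarith)
    (fun p hp hk => by
      by_contra hlt
      exact hk ⟨hRC hp, (not_le.1 hlt).le⟩) hS
  obtain ⟨hint, hle⟩ := hr_limit hRo.measurableSet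
    (fun p => p.2 ^ (2 * α) * (d₁ (fun q => (U q).1 - ut q) p) ^ 2) _ _
    (by
      refine ContinuousOn.aestronglyMeasurable ?_ hRo.measurableSet
      refine (continuousOn_snd.rpow_const fun _ _ => Or.inr (by linarith)).mul ?_
      exact ((hw1.continuousOn_fderiv_of_isOpen hRo le_rfl).clm_apply continuousOn_const).pow 2)
    (fun p hp => mul_nonneg (Real.rpow_nonneg hp.2.1.le _) (sq_nonneg _))
    (fun n p hp => mul_nonneg (Real.rpow_nonneg hp.2.1.le _)
      (mul_nonneg (hrθ_nonneg (1 / ((n:ℝ) + 1)) ((U p).1 - ut p)) (sq_nonneg _)))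
    (fun n => (hen n).1) (fun n => (hen n).2)
    (by
      filter_upwards [hr_null a h _ hwc hwd] with p hp
      by_cases h0 : (U p).1 - ut p = 0
      · simp [hp h0]
      · have := ((hrθ_tendsto h0).mul_const
          ((d₁ (fun q => (U q).1 - ut q) p) ^ 2)).const_mul (p.2 ^ (2 * α))
        simpa using this)
  constructor
  · have := hr_poincare2 a h (2 * α) hh (by linarith) _ hwc hwd
      (fun y hy => hfr _ ⟨⟨le_rfl, hh.le⟩, Set.Ioo_subset_Icc_self hy⟩
        (fun hc => lt_irrefl _ hc.1.1)) hint
    refine (Real.sqrt_le_sqrt this).trans (le_of_eq ?_)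
    rw [Real.sqrt_mul (sq_nonneg h), Real.sqrt_sq hh.le]
  · have hr : 0 < 1 - 2 * α := by linarith
    have hS0 : 0 ≤ ∫ p in R, p.2 ^ (2 * α) * strainNormSq U p := by
      refine setIntegral_nonneg hRo.measurableSet fun p hp => ?_
      refine mul_nonneg (Real.rpow_nonneg hp.2.1.le _) ?_
      unfold strainNormSq; positivity
    have h2 : 2 / (1 - 2 * α) * ∫ p in R, p.2 ^ (2 * α) * strainNormSq U p ≤
        (4 / (1 - 2 * α)) ^ 2 * ∫ p in R, p.2 ^ (2 * α) * strainNormSq U p := by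
      refine mul_le_mul_of_nonneg_right ?_ hS0
      rw [div_pow, div_le_div_iff₀ hr (by positivity)]
      nlinarith
    have h3 := Real.sqrt_le_sqrt (hle.trans h2)
    rw [Real.sqrt_mul (sq_nonneg _), Real.sqrt_sq (by positivity)] at h3
    refine (mul_le_mul_of_nonneg_left h3 hh.le).trans (le_of_eq ?_)
    ring
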